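/- Let Z be an asymmetric partition and let A°_Z = {X ∈ 𝒫 : δ(X, Z) < α_Z/4}. If 𝒮ₙ = (X₁, …, Xₙ) is a sample of partitions with Xᵢ ∈ A°_Z for all i, then the Fréchet function Fₙ of 𝒮ₙ has a unique global minimizer; that is, the mean partition of 𝒮ₙ is unique. -/

import Mathlib

/-!
Partition spaces for consensus clustering (Jain, "Condorcet's Jury Theorem for
Consensus Clustering").  Labeled partitions are ℓ×m column-stochastic matrices
with entries in [0,1]; the group Π of ℓ×ℓ permutation matrices acts by left
multiplication; partitions are orbits; δ is induced by the Frobenius norm.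
-/

namespace CJT

/-- ℓ×m real matrices. -/
abbrev Mat (l m : ℕ) := Matrix (Fin l) (Fin m) ℝ

/-- `P` is an ℓ×ℓ permutation matrix. -/
def IsPermMatrix {l : ℕ} (P : Matrix (Fin l) (Fin l) ℝ) : Prop :=
  ∃ σ : Equiv.Perm (Fin l), ∀ i k, P i k = if σ i = k then 1 else 0

/-- `X` is a labeled partition: entries in `[0,1]`, columns summing to one. -/
def IsLabeled {l m : ℕ} (X : Mat l m) : Prop :=
  (∀ i j, 0 ≤ X i j ∧ X i j ≤ 1) ∧ ∀ j, (∑ i, X i j) = 1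

/-- The orbit `[X] = {P X : P ∈ Π}` of a labeled partition. -/
def orbit {l m : ℕ} (X : Mat l m) : Set (Mat l m) :=
  {Y | ∃ P : Matrix (Fin l) (Fin l) ℝ, IsPermMatrix P ∧ Y = P * X}

/-- The partition space 𝒫: all orbits of labeled partitions. -/
def PartitionSpace (l m : ℕ) : Set (Set (Mat l m)) :=
  {A | ∃ X : Mat l m, IsLabeled X ∧ A = orbit X}

/-- Frobenius (Euclidean) norm. -/
noncomputable def frobNorm {l m : ℕ} (X : Mat l m) : ℝ :=
  Real.sqrt (∑ i, ∑ j, (X i j) ^ 2)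

/-- `δ(A, B) = min {‖X' − Y'‖ : X' ∈ A, Y' ∈ B}`. -/
noncomputable def pdist {l m : ℕ} (A B : Set (Mat l m)) : ℝ :=
  sInf {d | ∃ X ∈ A, ∃ Y ∈ B, d = frobNorm (X - Y)}

/-- The Fréchet function `Fₙ(Z) = (1/n) Σᵢ δ(Xᵢ, Z)²` of a sample
`𝒮ₙ = (X₁, …, Xₙ)` of `n` partitions. -/
noncomputable def frechet {l m n : ℕ} (s : Fin n → Set (Mat l m)) (A : Set (Mat l m)) : ℝ :=
  (1 / (n : ℝ)) * ∑ i, (pdist (s i) A) ^ 2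

/-- A mean partition of the sample `s`: a global minimizer of the Fréchet
function over the partition space 𝒫. -/
def IsMeanPartition {l m n : ℕ} (s : Fin n → Set (Mat l m)) (M : Set (Mat l m)) : Prop :=
  M ∈ PartitionSpace l m ∧ ∀ W ∈ PartitionSpace l m, frechet s M ≤ frechet s W

/-- The degree of asymmetry
`α_Z = min {‖Z' − P Z'‖ : Z' ∈ Z, P ∈ Π, P ≠ I}` of a partition `Z`. -/
noncomputable def asym {l m : ℕ} (A : Set (Mat l m)) : ℝ :=
  sInf {d | ∃ Z' ∈ A, ∃ P : Matrix (Fin l) (Fin l) ℝ,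
    IsPermMatrix P ∧ P ≠ 1 ∧ d = frobNorm (Z' - P * Z')}

section

variable {l m : ℕ}

lemma isPermMatrix_mul_eq_submatrix {P : Matrix (Fin l) (Fin l) ℝ} {σ : Equiv.Perm (Fin l)}
    (h : ∀ i k, P i k = if σ i = k then 1 else 0) (X : Mat l m) :
    P * X = X.submatrix σ id := by
  ext i j
  simp [Matrix.mul_apply, h]

lemma mem_orbit_iff {X Y : Mat l m} :
    Y ∈ orbit X ↔ ∃ σ : Equiv.Perm (Fin l), Y = X.submatrix σ id := by
  constructor
  · rintro ⟨P, ⟨σ, hσ⟩, rfl⟩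
    exact ⟨σ, isPermMatrix_mul_eq_submatrix hσ X⟩
  · rintro ⟨σ, rfl⟩
    exact ⟨fun i k => if σ i = k then 1 else 0, ⟨σ, fun _ _ => rfl⟩,
      (isPermMatrix_mul_eq_submatrix (fun _ _ => rfl) X).symm⟩

lemma self_mem_orbit (X : Mat l m) : X ∈ orbit X :=
  mem_orbit_iff.2 ⟨1, rfl⟩

lemma orbit_submatrix (X : Mat l m) (σ : Equiv.Perm (Fin l)) :
    orbit (X.submatrix σ id) = orbit X := by
  ext Y
  simp only [mem_orbit_iff]
  constructor
  · rintro ⟨τ, rfl⟩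
    exact ⟨σ * τ, rfl⟩
  · rintro ⟨τ, rfl⟩
    refine ⟨σ⁻¹ * τ, ?_⟩
    ext i j
    simp

lemma IsLabeled.submatrix {X : Mat l m} (hX : IsLabeled X) (σ : Equiv.Perm (Fin l)) :
    IsLabeled (X.submatrix σ id) :=
  ⟨fun i j => hX.1 (σ i) j, fun j => (Equiv.sum_comp σ fun i => X i j).trans (hX.2 j)⟩

lemma frobNorm_nonneg (X : Mat l m) : 0 ≤ frobNorm X := Real.sqrt_nonneg _

lemma frobNorm_sq (X : Mat l m) : frobNorm X ^ 2 = ∑ i, ∑ j, X i j ^ 2 :=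
  Real.sq_sqrt (by positivity)

lemma frobNorm_submatrix (X : Mat l m) (σ : Equiv.Perm (Fin l)) :
    frobNorm (X.submatrix σ id) = frobNorm X :=
  congrArg Real.sqrt (Equiv.sum_comp σ fun i => ∑ j, X i j ^ 2)

lemma frobNorm_submatrix_sub (X Y : Mat l m) (σ τ : Equiv.Perm (Fin l)) :
    frobNorm (X.submatrix σ id - Y.submatrix τ id) =
      frobNorm (X - Y.submatrix (τ * σ⁻¹ : Equiv.Perm (Fin l)) id) := by
  rw [← frobNorm_submatrix (X - _) σ]
  congr 1
  ext i j
  simp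

lemma frobNorm_eq_norm (X : Mat l m) :
    frobNorm X = ‖WithLp.toLp 2 (fun p : Fin l × Fin m => X p.1 p.2)‖ := by
  simp [frobNorm, EuclideanSpace.norm_eq, Fintype.sum_prod_type]

lemma frobNorm_sub_comm (X Y : Mat l m) : frobNorm (X - Y) = frobNorm (Y - X) := by
  simp only [frobNorm, Matrix.sub_apply, sub_sq_comm]

lemma frobNorm_sub_le (X Y W : Mat l m) :
    frobNorm (X - W) ≤ frobNorm (X - Y) + frobNorm (Y - W) := by
  simp only [frobNorm_eq_norm]
  refine le_trans (le_of_eq ?_) (norm_add_le _ _)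
  congr 1
  ext p
  simp

lemma eq_of_frobNorm_sub_sq_eq_zero {X Y : Mat l m} (h : frobNorm (X - Y) ^ 2 = 0) : X = Y := by
  rw [frobNorm_sq, Finset.sum_eq_zero_iff_of_nonneg (fun _ _ => by positivity)] at h
  ext i j
  have hi := h i (Finset.mem_univ i)
  rw [Finset.sum_eq_zero_iff_of_nonneg (fun _ _ => by positivity)] at hi
  exact sub_eq_zero.1 (pow_eq_zero_iff two_ne_zero |>.1 (hi j (Finset.mem_univ j)))

lemma pdist_nonneg (A B : Set (Mat l m)) : 0 ≤ pdist A B := by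
  refine Real.sInf_nonneg ?_
  rintro _ ⟨X, -, Y, -, rfl⟩
  exact frobNorm_nonneg _

lemma pdist_le {A B : Set (Mat l m)} {X Y : Mat l m} (hX : X ∈ A) (hY : Y ∈ B) :
    pdist A B ≤ frobNorm (X - Y) := by
  refine csInf_le ⟨0, ?_⟩ ⟨X, hX, Y, hY, rfl⟩
  rintro _ ⟨X, -, Y, -, rfl⟩
  exact frobNorm_nonneg _

lemma exists_pdist_orbit_eq (X Y : Mat l m) :
    ∃ σ : Equiv.Perm (Fin l), pdist (orbit X) (orbit Y) = frobNorm (X - Y.submatrix σ id) := by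
  have hset : {d | ∃ X' ∈ orbit X, ∃ Y' ∈ orbit Y, d = frobNorm (X' - Y')} =
      Set.range fun σ : Equiv.Perm (Fin l) => frobNorm (X - Y.submatrix σ id) := by
    ext d
    simp only [mem_orbit_iff]
    constructor
    · rintro ⟨_, ⟨σ, rfl⟩, _, ⟨τ, rfl⟩, rfl⟩
      exact ⟨τ * σ⁻¹, (frobNorm_submatrix_sub X Y σ τ).symm⟩
    · rintro ⟨σ, rfl⟩
      exact ⟨X, ⟨1, rfl⟩, _, ⟨σ, rfl⟩, rfl⟩
  obtain ⟨σ, hσ⟩ := (Set.range_nonempty fun σ : Equiv.Perm (Fin l) =>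
    frobNorm (X - Y.submatrix σ id)).csInf_mem (Set.finite_range _)
  exact ⟨σ, (congrArg sInf hset).trans hσ.symm⟩

lemma asym_orbit_le (z : Mat l m) {σ : Equiv.Perm (Fin l)} (hσ : σ ≠ 1) :
    asym (orbit z) ≤ frobNorm (z - z.submatrix σ id) := by
  refine csInf_le ⟨0, ?_⟩ ⟨z, self_mem_orbit z, fun i k => if σ i = k then 1 else 0,
    ⟨σ, fun _ _ => rfl⟩, fun h => hσ ?_, ?_⟩
  · rintro _ ⟨_, -, _, -, -, rfl⟩
    exact frobNorm_nonneg _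
  · ext1 i
    by_contra hne
    have h' := congrFun (congrFun h i) (σ i)
    have h0 : (1 : Matrix (Fin l) (Fin l) ℝ) i (σ i) = 0 :=
      Matrix.one_apply_ne (Ne.symm hne)
    simp [h0] at h'
  · rw [isPermMatrix_mul_eq_submatrix (σ := σ) (fun _ _ => rfl)]

lemma sum_sub_sq_eq {n : ℕ} (hn : 0 < n) (a : Fin n → ℝ) (y : ℝ) :
    ∑ i, (a i - y) ^ 2 = (1 / (2 * n : ℝ)) * ∑ i, ∑ j, (a i - a j) ^ 2 +
      n * ((n : ℝ)⁻¹ * ∑ i, a i - y) ^ 2 := by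
  have hn' : (n : ℝ) ≠ 0 := by positivity
  simp only [sub_sq, Finset.sum_add_distrib, Finset.sum_sub_distrib, ← Finset.mul_sum,
    ← Finset.sum_mul, Finset.sum_const, Finset.card_univ, Fintype.card_fin, nsmul_eq_mul]
  field_simp
  ring

/-- Decomposition of the sum of squared distances to a point into pairwise distances and the
distance of that point to the average. -/
lemma sum_frobNorm_sub_sq {n : ℕ} (hn : 0 < n) (a : Fin n → Mat l m) (y : Mat l m) :
    ∑ i, frobNorm (a i - y) ^ 2 = (1 / (2 * n : ℝ)) * ∑ i, ∑ j, frobNorm (a i - a j) ^ 2 +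
      n * frobNorm ((n : ℝ)⁻¹ • ∑ i, a i - y) ^ 2 := by
  have hcomm (f : Fin n → Fin l → Fin m → ℝ) :
      ∑ i, ∑ p, ∑ q, f i p q = ∑ p, ∑ q, ∑ i, f i p q := by
    rw [Finset.sum_comm]
    exact Finset.sum_congr rfl fun _ _ => Finset.sum_comm
  simp only [frobNorm_sq, hcomm, Finset.mul_sum, ← Finset.sum_add_distrib]
  refine Finset.sum_congr rfl fun p _ => Finset.sum_congr rfl fun q _ => ?_
  have h := sum_sub_sq_eq hn (fun i => a i p q) (y p q)
  simpa [Matrix.sum_apply, Finset.mul_sum] using h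

lemma isLabeled_average {n : ℕ} (hn : 0 < n) {x : Fin n → Mat l m} (hx : ∀ i, IsLabeled (x i)) :
    IsLabeled ((n : ℝ)⁻¹ • ∑ i, x i) := by
  have hn' : (0 : ℝ) < n := by positivity
  refine ⟨fun p q => ⟨?_, ?_⟩, fun q => ?_⟩
  · simp only [Matrix.smul_apply, Matrix.sum_apply, smul_eq_mul]
    exact mul_nonneg (by positivity) (Finset.sum_nonneg fun i _ => ((hx i).1 p q).1)
  · simp only [Matrix.smul_apply, Matrix.sum_apply, smul_eq_mul]
    rw [inv_mul_le_iff₀ hn', mul_one]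
    simpa using Finset.sum_le_sum fun i (_ : i ∈ Finset.univ) => ((hx i).1 p q).2
  · simp only [Matrix.smul_apply, Matrix.sum_apply, smul_eq_mul, ← Finset.mul_sum]
    rw [Finset.sum_comm]
    simp [hn'.ne', (hx _).2]

/-- Points within a quarter of the degree of asymmetry of `z` are in optimal position, and the
identity is the only permutation achieving this. -/
lemma frobNorm_sub_lt_of_ne_one {z x y : Mat l m} (hx : frobNorm (x - z) < asym (orbit z) / 4)
    (hy : frobNorm (y - z) < asym (orbit z) / 4) {σ : Equiv.Perm (Fin l)} (hσ : σ ≠ 1) :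
    frobNorm (x - y) < frobNorm (x - y.submatrix σ id) := by
  have h1 := frobNorm_sub_le x z y
  have h2 := frobNorm_sub_le z x (z.submatrix σ id)
  have h3 := frobNorm_sub_le x (y.submatrix σ id) (z.submatrix σ id)
  have h4 : frobNorm (y.submatrix σ id - z.submatrix σ id) = frobNorm (y - z) :=
    frobNorm_submatrix (y - z) σ
  have h5 := asym_orbit_le z hσ
  rw [frobNorm_sub_comm z y] at h1
  rw [frobNorm_sub_comm z x] at h2
  linarith

lemma exists_isLabeled_pdist_eq {A : Set (Mat l m)} (hA : A ∈ PartitionSpace l m) (z : Mat l m) :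
    ∃ x, IsLabeled x ∧ A = orbit x ∧ pdist A (orbit z) = frobNorm (x - z) := by
  obtain ⟨X, hX, rfl⟩ := hA
  obtain ⟨σ, hσ⟩ := exists_pdist_orbit_eq X z
  refine ⟨X.submatrix (σ⁻¹ : Equiv.Perm (Fin l)) id, hX.submatrix _,
    (orbit_submatrix X _).symm, hσ.trans ?_⟩
  simpa using (frobNorm_submatrix_sub X z σ⁻¹ 1).symm

/-- The sum of squared distances to any partition is bounded below by the sum of squared distances
of the aligned representations to their average, with equality only at the average. -/
lemma sum_frobNorm_sub_average_sq_le {n : ℕ} (hn : 0 < n) {z : Mat l m} {x : Fin n → Mat l m}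
    (hx : ∀ i, frobNorm (x i - z) < asym (orbit z) / 4) (y : Mat l m) :
    ∑ i, frobNorm (x i - (n : ℝ)⁻¹ • ∑ k, x k) ^ 2 ≤
        ∑ i, pdist (orbit (x i)) (orbit y) ^ 2 ∧
      (∑ i, pdist (orbit (x i)) (orbit y) ^ 2 ≤
          ∑ i, frobNorm (x i - (n : ℝ)⁻¹ • ∑ k, x k) ^ 2 →
        orbit y = orbit ((n : ℝ)⁻¹ • ∑ k, x k)) := by
  have hn' : (0 : ℝ) < n := by positivity
  choose τ hτ using fun i => exists_pdist_orbit_eq (x i) y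
  set a : Fin n → Mat l m := fun i => (x i).submatrix ((τ i)⁻¹ : Equiv.Perm (Fin l)) id with ha
  have hdist (i : Fin n) : pdist (orbit (x i)) (orbit y) = frobNorm (a i - y) :=
    (hτ i).trans (by simpa [ha] using (frobNorm_submatrix_sub (x i) y (τ i)⁻¹ 1).symm)
  have hpair (i j : Fin n) : frobNorm (a i - a j) =
      frobNorm (x i - (x j).submatrix ((τ j)⁻¹ * τ i : Equiv.Perm (Fin l)) id) := by
    simpa [ha] using frobNorm_submatrix_sub (x i) (x j) (τ i)⁻¹ (τ j)⁻¹
  have hlt (i j : Fin n) (h : τ i ≠ τ j) :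
      frobNorm (x i - x j) ^ 2 < frobNorm (a i - a j) ^ 2 := by
    rw [hpair]
    refine pow_lt_pow_left₀ (frobNorm_sub_lt_of_ne_one (hx i) (hx j) fun h' => h ?_)
      (frobNorm_nonneg _) two_ne_zero
    exact (inv_mul_eq_one.1 h').symm
  have hle (i j : Fin n) : frobNorm (x i - x j) ^ 2 ≤ frobNorm (a i - a j) ^ 2 := by
    by_cases h : τ i = τ j
    · rw [hpair, h, inv_mul_cancel]
      exact le_rfl
    · exact (hlt i j h).le
  have hsum : ∑ i, ∑ j, frobNorm (x i - x j) ^ 2 ≤ ∑ i, ∑ j, frobNorm (a i - a j) ^ 2 :=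
    Finset.sum_le_sum fun i _ => Finset.sum_le_sum fun j _ => hle i j
  have hzero : frobNorm ((n : ℝ)⁻¹ • ∑ k, x k - (n : ℝ)⁻¹ • ∑ k, x k) ^ 2 = 0 := by
    simp [frobNorm]
  simp only [hdist]
  rw [sum_frobNorm_sub_sq hn a y, sum_frobNorm_sub_sq hn x, hzero, mul_zero, add_zero]
  have hmul := mul_le_mul_of_nonneg_left hsum (by positivity : 0 ≤ 1 / (2 * n : ℝ))
  have hrest : 0 ≤ n * frobNorm ((n : ℝ)⁻¹ • ∑ i, a i - y) ^ 2 := by positivity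
  refine ⟨by linarith, fun heq => ?_⟩
  have hy : (n : ℝ)⁻¹ • ∑ i, a i = y := by
    refine eq_of_frobNorm_sub_sq_eq_zero ?_
    have : n * frobNorm ((n : ℝ)⁻¹ • ∑ i, a i - y) ^ 2 = 0 := by linarith
    exact (mul_eq_zero.1 this).resolve_left hn'.ne'
  have hτ_eq (i j : Fin n) : τ i = τ j := by
    by_contra h
    have hstrict : ∑ i, ∑ j, frobNorm (x i - x j) ^ 2 < ∑ i, ∑ j, frobNorm (a i - a j) ^ 2 :=
      Finset.sum_lt_sum (fun i _ => Finset.sum_le_sum fun j _ => hle i j) ⟨i, Finset.mem_univ i,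
        Finset.sum_lt_sum (fun j _ => hle i j) ⟨j, Finset.mem_univ j, hlt i j h⟩⟩
    have := mul_lt_mul_of_pos_left hstrict (by positivity : 0 < 1 / (2 * n : ℝ))
    linarith
  have hy' : y = ((n : ℝ)⁻¹ • ∑ k, x k).submatrix ((τ ⟨0, hn⟩)⁻¹ : Equiv.Perm (Fin l)) id := by
    rw [← hy]
    ext p q
    simp [ha, Matrix.sum_apply, hτ_eq _ ⟨0, hn⟩]
  rw [hy', orbit_submatrix]

end

/-- Let `Z` be an asymmetric partition and let
`A°_Z = {X ∈ 𝒫 : δ(X, Z) < α_Z/4}`.  If `𝒮ₙ = (X₁, …, Xₙ)` is a sample of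
`n ≥ 1` partitions with `Xᵢ ∈ A°_Z` for all `i`, then the Fréchet function of
`𝒮ₙ` has a unique global minimizer: the mean partition of `𝒮ₙ` is unique. -/
theorem mean_partition_unique_of_homogeneous (l m : ℕ) (hl : 1 ≤ l) (hm : 1 ≤ m)
    (n : ℕ) (hn : 0 < n)
    (Z : Set (Mat l m)) (hZ : Z ∈ PartitionSpace l m) (hasym : 0 < asym Z)
    (s : Fin n → Set (Mat l m)) (hs : ∀ i, s i ∈ PartitionSpace l m)
    (hball : ∀ i, pdist (s i) Z < asym Z / 4) :
    ∃! M, IsMeanPartition s M := by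
  obtain ⟨z, -, rfl⟩ := hZ
  choose x hxl hxs hxd using fun i => exists_isLabeled_pdist_eq (hs i) z
  have hx (i : Fin n) : frobNorm (x i - z) < asym (orbit z) / 4 := hxd i ▸ hball i
  obtain rfl : s = fun i => orbit (x i) := funext hxs
  have hle (A : Set (Mat l m)) (B : Set (Mat l m)) :
      frechet (fun i => orbit (x i)) A ≤ frechet (fun i => orbit (x i)) B ↔
        ∑ i, pdist (orbit (x i)) A ^ 2 ≤ ∑ i, pdist (orbit (x i)) B ^ 2 :=
    mul_le_mul_iff_right₀ (by positivity)
  have hmean : ∑ i, pdist (orbit (x i)) (orbit ((n : ℝ)⁻¹ • ∑ k, x k)) ^ 2 ≤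
      ∑ i, frobNorm (x i - (n : ℝ)⁻¹ • ∑ k, x k) ^ 2 :=
    Finset.sum_le_sum fun i _ => pow_le_pow_left₀ (pdist_nonneg _ _)
      (pdist_le (self_mem_orbit _) (self_mem_orbit _)) 2
  have hmem : orbit ((n : ℝ)⁻¹ • ∑ k, x k) ∈ PartitionSpace l m :=
    ⟨_, isLabeled_average hn hxl, rfl⟩
  refine ⟨orbit ((n : ℝ)⁻¹ • ∑ k, x k), ⟨hmem, ?_⟩, ?_⟩
  · rintro _ ⟨y, -, rfl⟩
    exact (hle _ _).2 (hmean.trans (sum_frobNorm_sub_average_sq_le hn hx y).1)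
  · rintro _ ⟨⟨y, -, rfl⟩, hmin⟩
    exact (sum_frobNorm_sub_average_sq_le hn hx y).2 (((hle _ _).1 (hmin _ hmem)).trans hmean)

end CJT
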